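/- Let A₁, B₁, A₂, B₂ be nonempty finite types and let P₁ be a projection on ℂ^(A₁×B₁) and P₂ a projection on ℂ^(A₂×B₂), each supporting a quantum channel. Then the no-signalling assisted simulation cost is sub-multiplicative: Σ(P₁ ⊠ P₂) ≤ Σ(P₁) · Σ(P₂). -/

import Mathlib

open Matrix Kronecker BigOperators
open scoped ComplexOrder

noncomputable section

/-- Loewner order: `M ≤ N` iff `N - M` is positive semidefinite. -/
def loe {n : Type*} [Fintype n] (M N : Matrix n n ℂ) : Prop := (N - M).PosSemidef

/-- A projection: Hermitian and idempotent. -/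
def IsProj {n : Type*} [Fintype n] (M : Matrix n n ℂ) : Prop := M.IsHermitian ∧ M * M = M

variable {A B : Type*} [Fintype A] [Fintype B] [DecidableEq A] [DecidableEq B]

/-- Partial trace over `A`. -/
def trA (M : Matrix (A × B) (A × B) ℂ) : Matrix B B ℂ :=
  Matrix.of fun b b' => ∑ a, M (a, b) (a, b')

/-- Partial trace over `B`. -/
def trB (M : Matrix (A × B) (A × B) ℂ) : Matrix A A ℂ :=
  Matrix.of fun a a' => ∑ b, M (a, b) (a', b)

/-- `P` supports a quantum channel: there is a PSD `J` supported on `P` with `Tr_B J = 1`. -/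
def SupportsChannel (P : Matrix (A × B) (A × B) ℂ) : Prop :=
  ∃ J : Matrix (A × B) (A × B) ℂ, J.PosSemidef ∧ P * J = J ∧ trB J = 1

/-- One-shot no-signalling assisted simulation cost (primal SDP). -/
def SigmaNS (P : Matrix (A × B) (A × B) ℂ) : ℝ :=
  sInf { x : ℝ | ∃ T : Matrix B B ℂ, T.IsHermitian ∧ x = T.trace.re ∧
    ∃ F : Matrix (A × B) (A × B) ℂ,
      loe 0 F ∧ loe F ((1 : Matrix A A ℂ) ⊗ₖ T) ∧ trB F = 1 ∧
      ((1 - P) * F).trace = 0 }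

/-- Tensor product of non-commutative bipartite graphs (projections). -/
def boxProd {A₁ B₁ A₂ B₂ : Type*}
    (P₁ : Matrix (A₁ × B₁) (A₁ × B₁) ℂ) (P₂ : Matrix (A₂ × B₂) (A₂ × B₂) ℂ) :
    Matrix ((A₁ × A₂) × (B₁ × B₂)) ((A₁ × A₂) × (B₁ × B₂)) ℂ :=
  Matrix.of fun x y =>
    P₁ (x.1.1, x.2.1) (y.1.1, y.2.1) * P₂ (x.1.2, x.2.2) (y.1.2, y.2.2)

/-- Feasible values of the primal program. -/
def feas (P : Matrix (A × B) (A × B) ℂ) : Set ℝ :=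
  { x : ℝ | ∃ T : Matrix B B ℂ, T.IsHermitian ∧ x = T.trace.re ∧
    ∃ F : Matrix (A × B) (A × B) ℂ,
      loe 0 F ∧ loe F ((1 : Matrix A A ℂ) ⊗ₖ T) ∧ trB F = 1 ∧
      ((1 - P) * F).trace = 0 }

open scoped Matrix.Norms.L2Operator MatrixOrder in
lemma exists_bound {n : Type*} [Fintype n] [DecidableEq n] (J : Matrix n n ℂ)
    (hJ : J.PosSemidef) : ∃ c : ℝ, ((c : ℂ) • (1 : Matrix n n ℂ) - J).PosSemidef := by
  refine ⟨‖J‖, ?_⟩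
  have h := IsSelfAdjoint.le_algebraMap_norm_self (a := J) hJ.1
  rw [Matrix.le_iff, Algebra.algebraMap_eq_smul_one] at h
  have e : ((‖J‖ : ℝ) : ℂ) • (1 : Matrix n n ℂ) = ‖J‖ • (1 : Matrix n n ℂ) := by
    ext i j
    simp [Matrix.smul_apply]
  rw [e]
  exact h

open scoped Pointwise in
lemma le_mul_sInf {c z : ℝ} {s : Set ℝ} (hc : 0 ≤ c) (hs : s.Nonempty)
    (h : ∀ y ∈ s, z ≤ c * y) : z ≤ c * sInf s := by
  have e : c * sInf s = sInf (c • s) := (Real.sInf_smul_of_nonneg hc _).symm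
  rw [e]
  refine le_csInf (hs.image _) ?_
  rintro _ ⟨y, hy, rfl⟩
  exact h y hy

lemma feas_nonempty (P : Matrix (A × B) (A × B) ℂ) (h : SupportsChannel P) :
    (feas P).Nonempty := by
  obtain ⟨J, hJ, hPJ, hT⟩ := h
  obtain ⟨c, hc⟩ := exists_bound J hJ
  refine ⟨_, (c : ℂ) • (1 : Matrix B B ℂ), ?_, rfl, J, ?_, ?_, hT, ?_⟩
  · ext i j
    by_cases hij : i = j
    · subst hij; simp
    · simp [Matrix.one_apply, hij, Ne.symm hij]
  · simpa [loe] using hJ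
  · unfold loe
    rwa [Matrix.kronecker_smul, Matrix.one_kronecker_one]
  · rw [sub_mul, one_mul, hPJ, sub_self, Matrix.trace_zero]

lemma psd_one_kron {T : Matrix B B ℂ} {F : Matrix (A × B) (A × B) ℂ}
    (h0 : loe 0 F) (h1 : loe F ((1 : Matrix A A ℂ) ⊗ₖ T)) :
    ((1 : Matrix A A ℂ) ⊗ₖ T).PosSemidef := by
  have := Matrix.PosSemidef.add h0 h1
  simpa using this

lemma feas_nonneg [Nonempty A] (P : Matrix (A × B) (A × B) ℂ) {x : ℝ} (hx : x ∈ feas P) :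
    0 ≤ x := by
  obtain ⟨T, hT, rfl, F, h0, h1, -, -⟩ := hx
  have h := psd_one_kron h0 h1
  obtain ⟨a⟩ := ‹Nonempty A›
  have h2 := h.submatrix (fun b : B => (a, b))
  have h3 : ((1 : Matrix A A ℂ) ⊗ₖ T).submatrix (fun b : B => (a, b)) (fun b : B => (a, b)) = T := by
    ext i j; simp
  rw [h3] at h2
  exact (Complex.le_def.1 h2.trace_nonneg).1

section box
variable {A₁ B₁ A₂ B₂ : Type*} [Fintype A₁] [Fintype B₁] [Fintype A₂] [Fintype B₂]
    [DecidableEq A₁] [DecidableEq B₁] [DecidableEq A₂] [DecidableEq B₂]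

lemma boxProd_psd {M : Matrix (A₁ × B₁) (A₁ × B₁) ℂ} {N : Matrix (A₂ × B₂) (A₂ × B₂) ℂ}
    (hM : M.PosSemidef) (hN : N.PosSemidef) : (boxProd M N).PosSemidef :=
  (hM.kronecker hN).submatrix (Equiv.prodProdProdComm A₁ A₂ B₁ B₂)

lemma boxProd_mul (M M' : Matrix (A₁ × B₁) (A₁ × B₁) ℂ) (N N' : Matrix (A₂ × B₂) (A₂ × B₂) ℂ) :
    boxProd M N * boxProd M' N' = boxProd (M * M') (N * N') := by
  have key : ∀ (M : Matrix (A₁ × B₁) (A₁ × B₁) ℂ) (N : Matrix (A₂ × B₂) (A₂ × B₂) ℂ),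
      boxProd M N = (M ⊗ₖ N).submatrix (Equiv.prodProdProdComm A₁ A₂ B₁ B₂)
        (Equiv.prodProdProdComm A₁ A₂ B₁ B₂) := fun _ _ => rfl
  rw [key, key, key, Matrix.submatrix_mul_equiv, Matrix.mul_kronecker_mul]

lemma boxProd_trace (M : Matrix (A₁ × B₁) (A₁ × B₁) ℂ) (N : Matrix (A₂ × B₂) (A₂ × B₂) ℂ) :
    (boxProd M N).trace = M.trace * N.trace := by
  rw [← Matrix.trace_kronecker]
  exact Equiv.sum_comp (Equiv.prodProdProdComm A₁ A₂ B₁ B₂) (fun i => (M ⊗ₖ N) i i)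

lemma boxProd_trB (M : Matrix (A₁ × B₁) (A₁ × B₁) ℂ) (N : Matrix (A₂ × B₂) (A₂ × B₂) ℂ) :
    trB (boxProd M N) = trB M ⊗ₖ trB N := by
  ext x y
  simp [trB, boxProd, Fintype.sum_prod_type, Finset.sum_mul_sum]

lemma feas_mul (P₁ : Matrix (A₁ × B₁) (A₁ × B₁) ℂ) (P₂ : Matrix (A₂ × B₂) (A₂ × B₂) ℂ)
    {x y : ℝ} (hx : x ∈ feas P₁) (hy : y ∈ feas P₂) : x * y ∈ feas (boxProd P₁ P₂) := by
  obtain ⟨T, hT, rfl, F, h0, h1, h2, h3⟩ := hx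
  obtain ⟨S, hS, rfl, G, g0, g1, g2, g3⟩ := hy
  have k2 := psd_one_kron g0 g1
  have f0 : F.PosSemidef := by simpa [loe] using h0
  have f1 : G.PosSemidef := by simpa [loe] using g0
  have im : ∀ {n : Type _} [Fintype n] {T : Matrix n n ℂ}, T.IsHermitian → T.trace.im = 0 := by
    intro n _ T hT
    have : star T.trace = T.trace := by rw [← Matrix.trace_conjTranspose, hT.eq]
    exact Complex.conj_eq_iff_im.1 this
  refine ⟨T ⊗ₖ S, ?_, ?_, boxProd F G, ?_, ?_, ?_, ?_⟩
  · unfold Matrix.IsHermitian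
    rw [Matrix.conjTranspose_kronecker, hT.eq, hS.eq]
  · rw [Matrix.trace_kronecker, Complex.mul_re, im hT, zero_mul, sub_zero]
  · have := boxProd_psd f0 f1
    simpa [loe] using this
  · have := (boxProd_psd h1 k2).add (boxProd_psd f0 g1)
    unfold loe
    convert this using 1
    ext ⟨⟨a, b⟩, c, d⟩ ⟨⟨a', b'⟩, c', d'⟩
    have e : (1 : Matrix (A₁ × A₂) (A₁ × A₂) ℂ) (a, b) (a', b')
        = (1 : Matrix A₁ A₁ ℂ) a a' * (1 : Matrix A₂ A₂ ℂ) b b' := by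
      rw [← Matrix.one_kronecker_one]; rfl
    simp only [Matrix.sub_apply, Matrix.add_apply, boxProd, Matrix.of_apply,
      Matrix.kroneckerMap_apply, e]
    ring
  · rw [boxProd_trB, h2, g2, Matrix.one_kronecker_one]
  · rw [sub_mul, one_mul, Matrix.trace_sub, sub_eq_zero] at h3 g3 ⊢
    rw [boxProd_mul, boxProd_trace, boxProd_trace, h3, g3]

end box

/-- The no-signalling assisted simulation cost is sub-multiplicative. -/
theorem sigma_submultiplicative
    {A₁ B₁ A₂ B₂ : Type*} [Fintype A₁] [Fintype B₁] [Fintype A₂] [Fintype B₂]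
    [DecidableEq A₁] [DecidableEq B₁] [DecidableEq A₂] [DecidableEq B₂]
    [Nonempty A₁] [Nonempty B₁] [Nonempty A₂] [Nonempty B₂]
    (P₁ : Matrix (A₁ × B₁) (A₁ × B₁) ℂ) (P₂ : Matrix (A₂ × B₂) (A₂ × B₂) ℂ)
    (hP₁ : IsProj P₁) (hP₂ : IsProj P₂)
    (hch₁ : SupportsChannel P₁) (hch₂ : SupportsChannel P₂) :
    SigmaNS (boxProd P₁ P₂) ≤ SigmaNS P₁ * SigmaNS P₂ := by
  have hb : ∀ x ∈ feas P₁, ∀ y ∈ feas P₂, SigmaNS (boxProd P₁ P₂) ≤ x * y := fun x hx y hy =>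
    csInf_le ⟨0, fun z hz => feas_nonneg (boxProd P₁ P₂) hz⟩ (feas_mul P₁ P₂ hx hy)
  have hn₁ := feas_nonempty P₁ hch₁
  have hn₂ := feas_nonempty P₂ hch₂
  have h1 : ∀ x ∈ feas P₁, SigmaNS (boxProd P₁ P₂) ≤ x * SigmaNS P₂ := fun x hx =>
    le_mul_sInf (feas_nonneg P₁ hx) hn₂ (hb x hx)
  have h2 : 0 ≤ SigmaNS P₂ := le_csInf hn₂ fun y hy => feas_nonneg P₂ hy
  rw [mul_comm]
  refine le_mul_sInf h2 hn₁ fun x hx => ?_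
  rw [mul_comm]
  exact h1 x hx
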